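/- Let (α,β) be a pair of projective-space parameters and set 𝒦_n(t) = ((α+β+2)_n/(β+1)_n) P_n^{(α+1,β)}(t) and I_0 = (1/2)(ψ(α+β+2) − ψ(α+1)). Then, as n → ∞, ∫_0^{π/2} log(1/sin θ) ( 𝒦_n(1)² − 𝒦_n(cos 2θ)² ) dν^{(α,β)}(θ) = I_0 · 𝒦_n(1)² − ( Γ(β+1)/(Γ(α+2)Γ(α+β+2)) ) · n^{2α+2} · ( log n − (ψ(α+1)+ψ(α+2))/2 ) + O(n^{2α+1} log n). (This is the expected chordal logarithmic energy of the harmonic ensemble.) -/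

import Mathlib

open MeasureTheory Finset Real Filter Asymptotics

/-- The Pochhammer symbol `(x)_n = x (x+1) ⋯ (x+n-1)`. -/
noncomputable def poch (x : ℝ) (n : ℕ) : ℝ := (ascPochhammer ℝ n).eval x

/-- The Jacobi polynomial `P_n^{(α,β)}`, via its standard explicit expansion
(equivalent to Rodrigues' formula). -/
noncomputable def jacobiP (α β : ℝ) (n : ℕ) (t : ℝ) : ℝ :=
  ∑ k ∈ Finset.range (n + 1),
    poch (α + k + 1) (n - k) / ((n - k).factorial : ℝ) *
      (poch (β + (n - k) + 1) k / (k.factorial : ℝ)) *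
      ((t - 1) / 2) ^ k * ((t + 1) / 2) ^ (n - k)

/-- The probability measure `ν^{(α,β)}` on `[0, π/2]` with density
`γ_{α,β}⁻¹ sin(θ)^{2α+1} cos(θ)^{2β+1}`, where
`γ_{α,β} = Γ(α+1)Γ(β+1)/(2Γ(α+β+2))`. -/
noncomputable def nuMeasure (α β : ℝ) : Measure ℝ :=
  (volume.restrict (Set.Ioo 0 (π / 2))).withDensity fun θ =>
    ENNReal.ofReal (2 * Real.Gamma (α + β + 2) / (Real.Gamma (α + 1) * Real.Gamma (β + 1)) *
      Real.sin θ ^ (2 * α + 1) * Real.cos θ ^ (2 * β + 1))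

/-- The digamma function `ψ = Γ'/Γ`. -/
noncomputable def digamma (x : ℝ) : ℝ := deriv Real.Gamma x / Real.Gamma x

/-- `(α,β)` is a pair of projective-space parameters, corresponding to
`ℝP^{d−1}`, `ℂP^{d−1}`, `ℍP^{d−1}` (`d ≥ 3`) or `𝕆P²`. -/
def IsProjParam (α β : ℝ) : Prop :=
  (∃ d : ℕ, 3 ≤ d ∧ α = ((d : ℝ) - 3) / 2 ∧ β = -(1 / 2)) ∨
  (∃ d : ℕ, 3 ≤ d ∧ α = (d : ℝ) - 2 ∧ β = 0) ∨
  (∃ d : ℕ, 3 ≤ d ∧ α = 2 * (d : ℝ) - 3 ∧ β = 1) ∨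
  (α = 7 ∧ β = 3)

/-- The projection kernel `𝒦_n(t) = ((α+β+2)_n/(β+1)_n) P_n^{(α+1,β)}(t)`
of the harmonic ensemble. -/
noncomputable def KK (α β : ℝ) (n : ℕ) (t : ℝ) : ℝ :=
  poch (α + β + 2) n / poch (β + 1) n * jacobiP (α + 1) β n t


/-! ### Pochhammer symbols and generalized binomial coefficients -/

theorem poch_succ (x : ℝ) (n : ℕ) : poch x (n + 1) = poch x n * (x + n) :=
  ascPochhammer_succ_eval n x

theorem poch_zero (x : ℝ) : poch x 0 = 1 := by simp [poch]

theorem poch_add (x : ℝ) (m n : ℕ) : poch x (m + n) = poch x m * poch (x + m) n := by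
  simp [poch, ← ascPochhammer_mul]

theorem poch_one (n : ℕ) : poch 1 n = n.factorial := ascPochhammer_eval_one ℝ n

theorem Gamma_add_natCast {x : ℝ} (hx : 0 < x) (n : ℕ) :
    Real.Gamma (x + n) = poch x n * Real.Gamma x := by
  induction n with
  | zero => simp [poch_zero]
  | succ n ih =>
    rw [poch_succ, Nat.cast_succ, ← add_assoc, Real.Gamma_add_one (by positivity), ih]
    ring

theorem poch_div_factorial (x : ℝ) (n : ℕ) :
    poch x n / (n.factorial : ℝ) = Ring.choose (x + n - 1) n := by
  rw [Ring.choose_eq_smul, Polynomial.descPochhammer_smeval_eq_ascPochhammer,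
    Polynomial.ascPochhammer_smeval_eq_eval, smul_eq_mul, poch, div_eq_inv_mul]
  congr 2
  ring

theorem neg_one_pow_mul_poch_div_factorial (x : ℝ) (n : ℕ) :
    (-1) ^ n * (poch x n / (n.factorial : ℝ)) = Ring.choose (-x) n := by
  rw [Ring.choose_neg, poch_div_factorial]
  rcases n.even_or_odd with hn | hn
  · rw [hn.neg_one_pow, Int.negOnePow_even _ (by exact_mod_cast hn)]
    simp
  · rw [hn.neg_one_pow, Int.negOnePow_odd _ (by exact_mod_cast hn)]
    simp [Units.smul_def]

theorem choose_add_eq_sum_range (r s : ℝ) (n : ℕ) :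
    Ring.choose (r + s) n =
      ∑ k ∈ Finset.range (n + 1), Ring.choose r k * Ring.choose s (n - k) := by
  rw [Ring.add_choose_eq n (Commute.all r s), Finset.Nat.sum_antidiagonal_eq_sum_range_succ_mk]

/-! ### Jacobi polynomials in powers of `u = (1 - t) / 2` -/

theorem jacobiP_one_sub_two_mul (a b : ℝ) (n : ℕ) (u : ℝ) :
    jacobiP a b n (1 - 2 * u) = ∑ k ∈ Finset.range (n + 1),
      Ring.choose (a + n) (n - k) * Ring.choose (b + n) k * (-1) ^ k *
        (u ^ k * (1 - u) ^ (n - k)) := by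
  refine Finset.sum_congr rfl fun k hk => ?_
  have hk' : k ≤ n := Nat.lt_succ_iff.mp (Finset.mem_range.mp hk)
  rw [poch_div_factorial, poch_div_factorial, Nat.cast_sub hk',
    show a + k + 1 + ((n : ℝ) - k) - 1 = a + n by ring,
    show b + ((n : ℝ) - k) + 1 + k - 1 = b + n by ring,
    show (1 - 2 * u - 1) / 2 = (-1) * u by ring, show (1 - 2 * u + 1) / 2 = 1 - u by ring, mul_pow]
  ring

theorem choose_mul_choose_sub (r : ℝ) {n j k : ℕ} (hkj : k ≤ j) (hjn : j ≤ n) :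
    Ring.choose (r + n) (n - k) * ((n - k).choose (j - k) : ℝ) =
      Ring.choose (r + n) (n - j) * Ring.choose (r + j) (j - k) := by
  have h := Ring.choose_smul_choose (r + (n : ℝ)) (show n - j ≤ n - k by omega)
  rw [show n - k - (n - j) = j - k by omega, Nat.cast_sub hjn,
    show r + n - ((n : ℝ) - j) = r + j by ring, nsmul_eq_mul] at h
  rw [← h, mul_comm, ← Nat.choose_symm (show j - k ≤ n - k by omega),
    show n - k - (j - k) = n - j by omega]

theorem jacobiP_one_sub_two_mul' (a b : ℝ) (n : ℕ) (u : ℝ) :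
    jacobiP a b n (1 - 2 * u) = ∑ j ∈ Finset.range (n + 1),
      (-1) ^ j * Ring.choose (a + n) (n - j) * Ring.choose (a + b + n + j) j * u ^ j := by
  rw [jacobiP_one_sub_two_mul]
  have h1 : ∀ k ∈ Finset.range (n + 1),
      Ring.choose (a + n) (n - k) * Ring.choose (b + n) k * (-1) ^ k * (u ^ k * (1 - u) ^ (n - k)) =
      ∑ j ∈ Finset.Ico k (n + 1), (-1) ^ j * Ring.choose (a + n) (n - j) *
        (Ring.choose (b + n) k * Ring.choose (a + j) (j - k)) * u ^ j := by
    intro k hk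
    have hk' : k ≤ n := Nat.lt_succ_iff.mp (Finset.mem_range.mp hk)
    rw [Finset.sum_Ico_eq_sum_range, show n + 1 - k = n - k + 1 by omega,
      show 1 - u = -u + 1 by ring, add_pow, Finset.mul_sum, Finset.mul_sum]
    refine Finset.sum_congr rfl fun i hi => ?_
    have hi' : i ≤ n - k := Nat.lt_succ_iff.mp (Finset.mem_range.mp hi)
    have h := choose_mul_choose_sub a (show k ≤ k + i by omega) (show k + i ≤ n by omega)
    rw [show k + i - k = i by omega] at h ⊢
    rw [neg_pow, one_pow, pow_add, pow_add]
    linear_combination (Ring.choose (b + n) k * (-1) ^ k * (-1) ^ i * u ^ k * u ^ i) * h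
  rw [Finset.sum_congr rfl h1, Finset.range_eq_Ico, Finset.sum_Ico_Ico_comm]
  refine Finset.sum_congr rfl fun j hj => ?_
  rw [← Finset.sum_mul, ← Finset.mul_sum, ← Finset.range_eq_Ico,
    show a + b + n + j = (b + n) + (a + j) by ring,
    choose_add_eq_sum_range (b + n) (a + j)]

theorem jacobiP_eval_one (a b : ℝ) (n : ℕ) :
    jacobiP a b n 1 = poch (a + 1) n / (n.factorial : ℝ) := by
  rw [jacobiP, Finset.sum_eq_single_of_mem 0 (by simp)]
  · simp [poch_zero]
  · intro k _ hk
    simp [hk]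

/-! ### The Beta integral and its logarithmic derivative -/

open ProbabilityTheory (beta beta_pos)

theorem integrableOn_beta {x y : ℝ} (hx : 0 < x) (hy : 0 < y) :
    IntegrableOn (fun u : ℝ => u ^ (x - 1) * (1 - u) ^ (y - 1)) (Set.Ioo 0 1) := by
  have h := Complex.betaIntegral_convergent (u := x) (v := y) (by simpa) (by simpa)
  rw [intervalIntegrable_iff_integrableOn_Ioo_of_le zero_le_one] at h
  refine IntegrableOn.congr_fun h.re (fun u hu => ?_) measurableSet_Ioo
  have h1 : (0 : ℝ) ≤ 1 - u := by linarith [hu.2]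
  have h2 : ((u : ℂ) ^ ((x : ℂ) - 1) * (1 - (u : ℂ)) ^ ((y : ℂ) - 1)) =
      ((u ^ (x - 1) * (1 - u) ^ (y - 1) : ℝ) : ℂ) := by
    rw [Complex.ofReal_mul, Complex.ofReal_cpow hu.1.le, Complex.ofReal_cpow h1]
    push_cast
    rfl
  rw [h2]
  simp

theorem integral_beta {x y : ℝ} (hx : 0 < x) (hy : 0 < y) :
    ∫ u in Set.Ioo (0 : ℝ) 1, u ^ (x - 1) * (1 - u) ^ (y - 1) = beta x y := by
  rw [ProbabilityTheory.beta_eq_betaIntegralReal x y hx hy, Complex.betaIntegral,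
    intervalIntegral.integral_of_le zero_le_one, integral_Ioc_eq_integral_Ioo,
    ← Complex.ofReal_re (∫ u in Set.Ioo (0 : ℝ) 1, _), ← integral_complex_ofReal]
  congr 1
  refine setIntegral_congr_fun measurableSet_Ioo fun u hu => ?_
  have h1 : (0 : ℝ) ≤ 1 - u := by linarith [hu.2]
  rw [Complex.ofReal_mul, Complex.ofReal_cpow hu.1.le, Complex.ofReal_cpow h1]
  push_cast
  rfl

/-- The logarithmic Beta integral, i.e. the derivative of `beta` in its first argument. -/
noncomputable def logBeta (x y : ℝ) : ℝ :=
  ∫ u in Set.Ioo (0 : ℝ) 1, Real.log u * (u ^ (x - 1) * (1 - u) ^ (y - 1))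

theorem abs_log_le_rpow_neg {u c : ℝ} (hu : u ∈ Set.Ioo (0 : ℝ) 1) (hc : 0 < c) :
    |Real.log u| ≤ u ^ (-c) / c := by
  rw [abs_of_neg (Real.log_neg hu.1 hu.2), ← Real.log_inv, Real.rpow_neg hu.1.le,
    ← Real.inv_rpow hu.1.le]
  exact Real.log_le_rpow_div (by have := hu.1; positivity) hc

theorem integrableOn_hasDerivAt_logBeta {x y : ℝ} (hx : 0 < x) (hy : 0 < y) :
    IntegrableOn (fun u : ℝ => Real.log u * (u ^ (x - 1) * (1 - u) ^ (y - 1))) (Set.Ioo 0 1) ∧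
      HasDerivAt (fun z => beta z y) (logBeta x y) x := by
  have key := hasDerivAt_integral_of_dominated_loc_of_deriv_le
    (μ := volume.restrict (Set.Ioo (0 : ℝ) 1)) (x₀ := x) (s := Set.Ioi (x / 2))
    (F := fun z u => u ^ (z - 1) * (1 - u) ^ (y - 1))
    (F' := fun z u => Real.log u * (u ^ (z - 1) * (1 - u) ^ (y - 1)))
    (bound := fun u => (u ^ (x / 4 - 1) * (1 - u) ^ (y - 1)) / (x / 4))
    (Ioi_mem_nhds (by linarith)) ?_ (integrableOn_beta hx hy) ?_ ?_
    ((integrableOn_beta (by positivity) hy).div_const _) ?_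
  · refine ⟨key.1, key.2.congr_of_eventuallyEq ?_⟩
    filter_upwards [Ioi_mem_nhds hx] with z hz
    exact (integral_beta hz hy).symm
  · exact Eventually.of_forall fun z => Measurable.aestronglyMeasurable (by fun_prop)
  · exact Measurable.aestronglyMeasurable (by fun_prop)
  · refine ae_restrict_of_forall_mem measurableSet_Ioo fun u hu z hz => ?_
    have hz' : x / 2 < z := hz
    have h1 : 0 < (1 - u) ^ (y - 1) := Real.rpow_pos_of_pos (by linarith [hu.2]) _
    have h0 : 0 < u ^ (z - 1) := Real.rpow_pos_of_pos hu.1 _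
    have h2 : u ^ (z - 1) ≤ u ^ (x / 2 - 1) :=
      Real.rpow_le_rpow_of_exponent_ge hu.1 hu.2.le (by linarith)
    rw [Real.norm_eq_abs, abs_mul, abs_of_pos (mul_pos h0 h1)]
    calc |Real.log u| * (u ^ (z - 1) * (1 - u) ^ (y - 1))
        ≤ (u ^ (-(x / 4)) / (x / 4)) * (u ^ (x / 2 - 1) * (1 - u) ^ (y - 1)) := by
          have h3 := abs_log_le_rpow_neg hu (show 0 < x / 4 by positivity)
          exact mul_le_mul h3 (mul_le_mul_of_nonneg_right h2 h1.le) (by positivity)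
            ((abs_nonneg _).trans h3)
      _ = _ := by
          rw [show x / 4 - 1 = -(x / 4) + (x / 2 - 1) by ring, Real.rpow_add hu.1]
          ring
  · refine ae_restrict_of_forall_mem measurableSet_Ioo fun u hu z _ => ?_
    have h := ((hasDerivAt_id z).sub_const 1).const_rpow hu.1
    have h' := h.mul_const ((1 - u) ^ (y - 1))
    refine h'.congr_deriv ?_
    simp
    ring

theorem integrableOn_logBeta {x y : ℝ} (hx : 0 < x) (hy : 0 < y) :
    IntegrableOn (fun u : ℝ => Real.log u * (u ^ (x - 1) * (1 - u) ^ (y - 1))) (Set.Ioo 0 1) :=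
  (integrableOn_hasDerivAt_logBeta hx hy).1

theorem hasDerivAt_beta {x y : ℝ} (hx : 0 < x) (hy : 0 < y) :
    HasDerivAt (fun z => beta z y) (logBeta x y) x :=
  (integrableOn_hasDerivAt_logBeta hx hy).2

/-! ### The digamma function -/

theorem hasDerivAt_log_Gamma {x : ℝ} (hx : 0 < x) :
    HasDerivAt (fun z => Real.log (Real.Gamma z)) (digamma x) x :=
  ((Real.differentiableAt_Gamma fun m => by
    have : (0 : ℝ) ≤ m := m.cast_nonneg
    linarith).hasDerivAt).log (Real.Gamma_pos_of_pos hx).ne'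

theorem log_Gamma_add_one {x : ℝ} (hx : 0 < x) :
    Real.log (Real.Gamma (x + 1)) = Real.log (Real.Gamma x) + Real.log x := by
  rw [Real.Gamma_add_one hx.ne', Real.log_mul hx.ne' (Real.Gamma_pos_of_pos hx).ne', add_comm]

theorem digamma_add_one {x : ℝ} (hx : 0 < x) : digamma (x + 1) = digamma x + 1 / x := by
  have h1 : HasDerivAt (fun z => Real.log (Real.Gamma (z + 1))) (digamma (x + 1)) x :=
    (hasDerivAt_log_Gamma (show 0 < x + 1 by linarith)).comp_add_const x 1
  have h2 := (hasDerivAt_log_Gamma hx).add (Real.hasDerivAt_log hx.ne')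
  rw [one_div]
  refine h1.unique (h2.congr_of_eventuallyEq ?_)
  filter_upwards [Ioi_mem_nhds hx] with z hz using log_Gamma_add_one hz

theorem digamma_le_log {x : ℝ} (hx : 0 < x) : digamma x ≤ Real.log x := by
  have h := Real.convexOn_log_Gamma.le_slope_of_hasDerivAt (x := x) (y := x + 1)
    hx (show 0 < x + 1 by linarith) (by linarith) (hasDerivAt_log_Gamma hx)
  rw [slope_def_field] at h
  simp only [Function.comp_apply, log_Gamma_add_one hx] at h
  simpa using h

theorem log_sub_le_digamma {x : ℝ} (hx : 0 < x) : Real.log x - 1 / x ≤ digamma x := by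
  have hx1 : 0 < x + 1 := by linarith
  have h := Real.convexOn_log_Gamma.slope_le_of_hasDerivAt (x := x) (y := x + 1)
    hx hx1 (by linarith) (hasDerivAt_log_Gamma hx1)
  rw [slope_def_field] at h
  simp only [Function.comp_apply, log_Gamma_add_one hx, digamma_add_one hx] at h
  have : Real.log x ≤ digamma x + 1 / x := by simpa using h
  linarith

theorem digamma_add_natCast {x : ℝ} (hx : 0 < x) (n : ℕ) :
    digamma (x + n) = digamma x + ∑ j ∈ Finset.range n, 1 / (x + j) := by
  induction n with
  | zero => simp
  | succ n ih =>
    rw [Nat.cast_succ, ← add_assoc, digamma_add_one (by positivity), ih, Finset.sum_range_succ]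
    ring

theorem logBeta_eq {x y : ℝ} (hx : 0 < x) (hy : 0 < y) :
    logBeta x y = beta x y * (digamma x - digamma (x + y)) := by
  have hxy : 0 < x + y := by linarith
  have h := ((hasDerivAt_log_Gamma hx).add_const (Real.log (Real.Gamma y))).sub
    ((hasDerivAt_log_Gamma hxy).comp_add_const x y)
  have h2 := (hasDerivAt_beta hx hy).log (beta_pos hx hy).ne'
  have h3 := h2.unique (h.congr_of_eventuallyEq ?_)
  · rw [div_eq_iff (beta_pos hx hy).ne'] at h3
    rw [h3, mul_comm]
  · filter_upwards [Ioi_mem_nhds hx] with z hz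
    have hz' : 0 < z := hz
    simp only [beta, Pi.sub_apply]
    rw [Real.log_div (mul_pos (Real.Gamma_pos_of_pos hz') (Real.Gamma_pos_of_pos hy)).ne'
      (Real.Gamma_pos_of_pos (by linarith)).ne',
      Real.log_mul (Real.Gamma_pos_of_pos hz').ne' (Real.Gamma_pos_of_pos hy).ne']

/-! ### The logarithmic moment of a squared Jacobi polynomial -/

theorem sum_choose_mul_beta (a : ℝ) {b x : ℝ} (hb : -1 < b) (hx : 0 < x) (n : ℕ) :
    ∑ k ∈ Finset.range (n + 1), Ring.choose (a + n) (n - k) * Ring.choose (b + n) k * (-1) ^ k *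
        beta (x + k) (b + (n - k : ℕ) + 1) =
      beta x (b + n + 1) * (poch (a + 1 - x) n / (n.factorial : ℝ)) := by
  rw [poch_div_factorial, show a + 1 - x + n - 1 = -x + (a + n) by ring,
    choose_add_eq_sum_range, Finset.mul_sum]
  refine Finset.sum_congr rfl fun k hk => ?_
  have hk' : k ≤ n := Nat.lt_succ_iff.mp (Finset.mem_range.mp hk)
  have hy : 0 < b + (n - k : ℕ) + 1 := by
    have : (0 : ℝ) ≤ (n - k : ℕ) := Nat.cast_nonneg _
    linarith
  have hcast : ((n - k : ℕ) : ℝ) = n - k := Nat.cast_sub hk'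
  have h1 := Gamma_add_natCast hx k
  have h2 := Gamma_add_natCast hy k
  rw [show b + (n - k : ℕ) + 1 + (k : ℝ) = b + n + 1 by rw [hcast]; ring] at h2
  have h3 := poch_div_factorial (b + (n - k : ℕ) + 1) k
  rw [show b + (n - k : ℕ) + 1 + (k : ℝ) - 1 = b + n by rw [hcast]; ring] at h3
  rw [← h3, ← neg_one_pow_mul_poch_div_factorial, beta, beta, h1, h2,
    show x + k + (b + (n - k : ℕ) + 1) = x + (b + n + 1) by rw [hcast]; ring]
  ring

theorem differentiable_poch (n : ℕ) : Differentiable ℝ fun z => poch z n :=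
  (ascPochhammer ℝ n).differentiable

theorem poch_neg_natCast (j : ℕ) : poch (-j) j = (-1) ^ j * j.factorial := by
  have h := neg_one_pow_mul_poch_div_factorial (-(j : ℝ)) j
  rw [neg_neg, Ring.choose_natCast, Nat.choose_self, Nat.cast_one] at h
  have hj : (j.factorial : ℝ) ≠ 0 := by positivity
  have hs : ((-1 : ℝ) ^ j) * (-1) ^ j = 1 := by rw [← mul_pow]; simp
  field_simp at h
  linear_combination (-1 : ℝ) ^ j * h - poch (-(j : ℝ)) j * hs

theorem poch_neg_eq_zero {j n : ℕ} (hj : j < n) : poch (-j) n = 0 := by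
  obtain ⟨i, rfl⟩ := Nat.exists_eq_add_of_lt hj
  rw [show j + i + 1 = j + 1 + i by ring, poch_add, poch_succ]
  simp

theorem hasDerivAt_poch_neg {j n : ℕ} (hj : j < n) :
    HasDerivAt (fun z => poch z n) ((-1) ^ j * j.factorial * (n - j - 1).factorial) (-j) := by
  obtain ⟨i, rfl⟩ := Nat.exists_eq_add_of_lt hj
  have h1 := (differentiable_poch j (-j)).hasDerivAt
  have h2 : HasDerivAt (fun z : ℝ => z + j) 1 (-j) := (hasDerivAt_id _).add_const _
  have h3 := ((differentiable_poch i).comp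
    (differentiable_id.add_const ((j + 1 : ℕ) : ℝ)) (-j)).hasDerivAt
  have h := (h1.mul h2).mul h3
  refine (h.congr_of_eventuallyEq (Eventually.of_forall fun z => ?_)).congr_deriv ?_
  · simp only [Pi.mul_apply, Function.comp_apply, id]
    rw [show j + i + 1 = j + 1 + i by ring, poch_add, poch_succ]
  · simp [poch_neg_natCast, poch_one, show j + i + 1 - j - 1 = i by omega]

theorem hasDerivAt_poch_one (n : ℕ) :
    HasDerivAt (fun z => poch z n) (n.factorial * ∑ j ∈ Finset.range n, 1 / ((j : ℝ) + 1)) 1 := by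
  induction n with
  | zero => simpa [poch_zero] using hasDerivAt_const (1 : ℝ) (1 : ℝ)
  | succ n ih =>
    have h := ih.mul ((hasDerivAt_id (1 : ℝ)).add_const (n : ℝ))
    refine (h.congr_of_eventuallyEq (Eventually.of_forall fun z => ?_)).congr_deriv ?_
    · simp [poch_succ]
    · rw [Finset.sum_range_succ, Nat.factorial_succ, poch_one]
      push_cast
      simp only [id]
      field_simp
      ring

theorem sum_choose_mul_logBeta (a : ℝ) {b x d : ℝ} (hb : -1 < b) (hx : 0 < x) (n : ℕ)
    (hd : HasDerivAt (fun z => poch z n) d (a + 1 - x)) :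
    ∑ k ∈ Finset.range (n + 1), Ring.choose (a + n) (n - k) * Ring.choose (b + n) k * (-1) ^ k *
        logBeta (x + k) (b + (n - k : ℕ) + 1) =
      (logBeta x (b + n + 1) * poch (a + 1 - x) n - beta x (b + n + 1) * d) /
        (n.factorial : ℝ) := by
  have hy : ∀ m : ℕ, 0 < b + m + 1 := fun m => by
    have : (0 : ℝ) ≤ m := m.cast_nonneg
    linarith
  have hl : HasDerivAt (fun z => ∑ k ∈ Finset.range (n + 1), Ring.choose (a + n) (n - k) *
      Ring.choose (b + n) k * (-1) ^ k * beta (z + k) (b + (n - k : ℕ) + 1))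
      (∑ k ∈ Finset.range (n + 1), Ring.choose (a + n) (n - k) * Ring.choose (b + n) k *
        (-1) ^ k * logBeta (x + k) (b + (n - k : ℕ) + 1)) x :=
    HasDerivAt.fun_sum fun k _ =>
      ((hasDerivAt_beta (show 0 < x + k by positivity) (hy _)).comp_add_const x k).const_mul _
  have hr := (hasDerivAt_beta hx (hy n)).mul
    ((HasDerivAt.comp_const_sub (a + 1) x hd).div_const (n.factorial : ℝ))
  rw [hl.unique (hr.congr_of_eventuallyEq ?_)]
  · ring
  · filter_upwards [Ioi_mem_nhds hx] with z hz
    exact sum_choose_mul_beta a hb hz n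

theorem choose_mul_beta_mul_factorial {a b : ℝ} (ha : 0 < a) (hb : -1 < b) {m n : ℕ} (hm : m ≤ n)
    (hm0 : m ≠ 0) :
    Ring.choose (a + n) (n - m) * Ring.choose (a + b + n + m) m * beta (a + m) (b + n + 1) *
        ((m - 1).factorial * (n - m).factorial / (n.factorial : ℝ)) =
      poch (a + 1) n / (n.factorial : ℝ) * beta a (b + n + 1) * (1 / m - 1 / (a + m)) := by
  have hB : 0 < b + n + 1 := by
    have : (0 : ℝ) ≤ n := n.cast_nonneg
    linarith
  have hs : 0 < a + (b + n + 1) := by linarith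
  have hcast : ((n - m : ℕ) : ℝ) = n - m := Nat.cast_sub hm
  have h1 := poch_div_factorial (a + m + 1) (n - m)
  rw [hcast, show a + m + 1 + ((n : ℝ) - m) - 1 = a + n by ring] at h1
  have h2 := poch_div_factorial (a + (b + n + 1)) m
  rw [show a + (b + n + 1) + (m : ℝ) - 1 = a + b + n + m by ring] at h2
  have h3 := Gamma_add_natCast ha m
  have h4 := Gamma_add_natCast hs m
  have h5 := poch_add a (m + 1) (n - m)
  rw [show m + 1 + (n - m) = 1 + n by omega, poch_add, poch_succ a m,
    show poch a 1 = a by simp [poch], Nat.cast_one, Nat.cast_succ, ← add_assoc] at h5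
  have hm1 : (m.factorial : ℝ) = m * (m - 1).factorial := by
    exact_mod_cast (Nat.mul_factorial_pred hm0).symm
  have hmm : (m : ℝ) ≠ 0 := by exact_mod_cast hm0
  have ham : a + m ≠ 0 := by positivity
  have hp : poch (a + (b + n + 1)) m ≠ 0 := (ascPochhammer_pos m _ hs).ne'
  have hG : Real.Gamma (a + (b + n + 1)) ≠ 0 := (Real.Gamma_pos_of_pos hs).ne'
  have hf : ((m - 1).factorial : ℝ) ≠ 0 := by positivity
  have hf' : ((n - m).factorial : ℝ) ≠ 0 := by positivity
  rw [← h1, ← h2, beta, beta, show a + m + (b + n + 1) = a + (b + n + 1) + m by ring, h3, h4, hm1]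
  field_simp
  linear_combination -h5

theorem integral_log_mul_jacobiP_sq {a b : ℝ} (ha : 0 < a) (hb : -1 < b) (n : ℕ) :
    IntegrableOn (fun u : ℝ => Real.log u *
      (jacobiP a b n (1 - 2 * u) ^ 2 * (u ^ (a - 1) * (1 - u) ^ b))) (Set.Ioo 0 1) ∧
    ∫ u in Set.Ioo (0 : ℝ) 1, Real.log u *
        (jacobiP a b n (1 - 2 * u) ^ 2 * (u ^ (a - 1) * (1 - u) ^ b)) =
      poch (a + 1) n / (n.factorial : ℝ) * beta a (b + n + 1) *
        (digamma a + digamma (a + 1) - digamma (a + b + n + 1) - digamma (a + n + 1)) := by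
  have hy : ∀ m : ℕ, 0 < b + m + 1 := fun m => by
    have : (0 : ℝ) ≤ m := m.cast_nonneg
    linarith
  have hx : ∀ j k : ℕ, 0 < a + j + k := fun j k => by positivity
  set c : ℕ → ℝ := fun j =>
    (-1) ^ j * Ring.choose (a + n) (n - j) * Ring.choose (a + b + n + j) j with hc
  set d : ℕ → ℝ := fun k =>
    Ring.choose (a + n) (n - k) * Ring.choose (b + n) k * (-1) ^ k with hd
  have hterm : ∀ j k : ℕ, IntegrableOn (fun u : ℝ => c j * (d k * (Real.log u *
      (u ^ (a + j + k - 1) * (1 - u) ^ (b + (n - k : ℕ) + 1 - 1))))) (Set.Ioo 0 1) := fun j k =>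
    ((integrableOn_logBeta (hx j k) (hy (n - k))).const_mul _).const_mul _
  have hexp : Set.EqOn (fun u : ℝ => ∑ j ∈ Finset.range (n + 1), ∑ k ∈ Finset.range (n + 1),
        c j * (d k * (Real.log u * (u ^ (a + j + k - 1) * (1 - u) ^ (b + (n - k : ℕ) + 1 - 1)))))
      (fun u : ℝ => Real.log u * (jacobiP a b n (1 - 2 * u) ^ 2 * (u ^ (a - 1) * (1 - u) ^ b)))
      (Set.Ioo 0 1) := fun u hu => by
    have hu1 : 0 < 1 - u := by linarith [hu.2]
    simp only
    rw [pow_two]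
    nth_rw 1 [jacobiP_one_sub_two_mul']
    rw [jacobiP_one_sub_two_mul, Finset.sum_mul_sum, Finset.sum_mul, Finset.mul_sum]
    refine Finset.sum_congr rfl fun j _ => ?_
    rw [Finset.sum_mul, Finset.mul_sum]
    refine Finset.sum_congr rfl fun k _ => ?_
    rw [show a + j + k - 1 = a - 1 + j + k by ring, add_sub_cancel_right, Real.rpow_add hu.1,
      Real.rpow_add hu.1, Real.rpow_add hu1]
    simp only [Real.rpow_natCast, hc, hd]
    ring
  have hint : IntegrableOn (fun u : ℝ => ∑ j ∈ Finset.range (n + 1), ∑ k ∈ Finset.range (n + 1),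
      c j * (d k * (Real.log u * (u ^ (a + j + k - 1) * (1 - u) ^ (b + (n - k : ℕ) + 1 - 1)))))
      (Set.Ioo 0 1) :=
    integrable_finsetSum _ fun j _ => integrable_finsetSum _ fun k _ => hterm j k
  refine ⟨hint.congr_fun hexp measurableSet_Ioo, ?_⟩
  rw [← setIntegral_congr_fun measurableSet_Ioo hexp,
    integral_finsetSum _ fun j _ => integrable_finsetSum _ fun k _ => hterm j k]
  have hsum : ∀ j : ℕ, ∫ u in Set.Ioo (0 : ℝ) 1, ∑ k ∈ Finset.range (n + 1),
      c j * (d k * (Real.log u * (u ^ (a + j + k - 1) * (1 - u) ^ (b + (n - k : ℕ) + 1 - 1)))) =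
      c j * ∑ k ∈ Finset.range (n + 1), d k * logBeta (a + j + k) (b + (n - k : ℕ) + 1) := by
    intro j
    rw [integral_finsetSum _ fun k _ => hterm j k, Finset.mul_sum]
    refine Finset.sum_congr rfl fun k _ => ?_
    rw [integral_const_mul, integral_const_mul, logBeta]
  rw [Finset.sum_congr rfl fun j _ => hsum j, Finset.sum_range_succ']
  have hsucc : ∀ j ∈ Finset.range n,
      c (j + 1) * ∑ k ∈ Finset.range (n + 1),
        d k * logBeta (a + (j + 1 : ℕ) + k) (b + (n - k : ℕ) + 1) =
      poch (a + 1) n / (n.factorial : ℝ) * beta a (b + n + 1) *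
        (1 / ((j : ℝ) + 1) - 1 / (a + 1 + j)) := by
    intro j hj
    have hj' : j < n := Finset.mem_range.mp hj
    have hz : a + 1 - (a + (j + 1 : ℕ)) = -(j : ℝ) := by push_cast; ring
    rw [sum_choose_mul_logBeta a hb (by positivity) n (hz ▸ hasDerivAt_poch_neg hj'), hz,
      poch_neg_eq_zero hj']
    have h := choose_mul_beta_mul_factorial ha hb (show j + 1 ≤ n from hj') j.succ_ne_zero
    have hs : ((-1 : ℝ) ^ j) * (-1) ^ j = 1 := by rw [← mul_pow]; simp
    rw [Nat.add_sub_cancel, Nat.cast_succ, show a + ((j : ℝ) + 1) = a + 1 + j by ring] at h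
    rw [← h, Nat.sub_sub, hc]
    simp only [Nat.cast_succ, show a + ((j : ℝ) + 1) = a + 1 + j by ring, pow_succ]
    linear_combination (Ring.choose (a + n) (n - (j + 1)) *
      Ring.choose (a + b + n + (j + 1)) (j + 1) * beta (a + 1 + j) (b + n + 1) *
      (j.factorial * (n - (j + 1)).factorial / (n.factorial : ℝ))) * hs
  have hzero : c 0 * ∑ k ∈ Finset.range (n + 1),
      d k * logBeta (a + (0 : ℕ) + k) (b + (n - k : ℕ) + 1) =
      poch (a + 1) n / (n.factorial : ℝ) * beta a (b + n + 1) *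
        (digamma a - digamma (a + b + n + 1) - ∑ j ∈ Finset.range n, 1 / ((j : ℝ) + 1)) := by
    have hz : a + 1 - (a + (0 : ℕ)) = 1 := by push_cast; ring
    rw [sum_choose_mul_logBeta a hb (by simpa using ha) n (hz ▸ hasDerivAt_poch_one n), hz,
      poch_one, Nat.cast_zero, add_zero, logBeta_eq ha (hy n), hc]
    simp only [pow_zero, Nat.sub_zero, Ring.choose_zero_right, poch_div_factorial,
      show a + 1 + n - 1 = a + n by ring, show a + (b + n + 1) = a + b + n + 1 by ring]
    field_simp
  rw [Finset.sum_congr rfl hsucc, hzero, ← Finset.mul_sum, ← mul_add, Finset.sum_sub_distrib,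
    show a + n + 1 = a + 1 + n by ring, digamma_add_natCast (show 0 < a + 1 by linarith)]
  ring

/-! ### The energy integral in closed form -/

theorem image_sin_sq_Ioo :
    (fun θ => Real.sin θ ^ 2) '' Set.Ioo 0 (π / 2) = Set.Ioo 0 1 := by
  ext u
  constructor
  · rintro ⟨θ, hθ, rfl⟩
    have h1 : 0 < Real.sin θ := Real.sin_pos_of_pos_of_lt_pi hθ.1 (by linarith [hθ.2, pi_pos])
    have h2 : 0 < Real.cos θ := Real.cos_pos_of_mem_Ioo ⟨by linarith [hθ.1, pi_pos], hθ.2⟩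
    exact ⟨by positivity, by nlinarith [Real.sin_sq_add_cos_sq θ]⟩
  · intro hu
    have h0 : 0 < √u := Real.sqrt_pos.mpr hu.1
    have h1 : √u < 1 := (Real.sqrt_lt' one_pos).mpr (by simpa using hu.2)
    refine ⟨Real.arcsin √u, ⟨Real.arcsin_pos.mpr h0, Real.arcsin_lt_pi_div_two.mpr h1⟩, ?_⟩
    simp only
    rw [Real.sin_arcsin (by linarith) h1.le, Real.sq_sqrt hu.1.le]

theorem integral_nuMeasure {α β : ℝ} (hα : -1 < α) (hβ : -1 < β) (f : ℝ → ℝ) :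
    ∫ θ, f (Real.sin θ ^ 2) ∂(nuMeasure α β) =
      (beta (α + 1) (β + 1))⁻¹ * ∫ u in Set.Ioo (0 : ℝ) 1, f u * (u ^ α * (1 - u) ^ β) := by
  have hG1 : 0 < Real.Gamma (α + 1) := Real.Gamma_pos_of_pos (by linarith)
  have hG2 : 0 < Real.Gamma (β + 1) := Real.Gamma_pos_of_pos (by linarith)
  have hG3 : 0 < Real.Gamma (α + β + 2) := Real.Gamma_pos_of_pos (by linarith)
  have hinj : Set.InjOn (fun θ => Real.sin θ ^ 2) (Set.Ioo 0 (π / 2)) := by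
    intro x hx y hy hxy
    have hx1 : 0 < Real.sin x := Real.sin_pos_of_pos_of_lt_pi hx.1 (by linarith [hx.2, pi_pos])
    have hy1 : 0 < Real.sin y := Real.sin_pos_of_pos_of_lt_pi hy.1 (by linarith [hy.2, pi_pos])
    refine Real.injOn_sin ⟨by linarith [hx.1, pi_pos], hx.2.le⟩
      ⟨by linarith [hy.1, pi_pos], hy.2.le⟩ ?_
    exact (pow_left_inj₀ hx1.le hy1.le two_ne_zero).mp hxy
  have hderiv : ∀ θ ∈ Set.Ioo 0 (π / 2), HasDerivWithinAt (fun θ => Real.sin θ ^ 2)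
      (2 * Real.sin θ * Real.cos θ) (Set.Ioo 0 (π / 2)) θ := fun θ _ => by
    have h := (Real.hasDerivAt_sin θ).fun_pow 2
    simpa using h.hasDerivWithinAt
  rw [← image_sin_sq_Ioo, integral_image_eq_integral_abs_deriv_smul measurableSet_Ioo hderiv hinj,
    nuMeasure, integral_withDensity_eq_integral_toReal_smul (by fun_prop)
      (Eventually.of_forall fun _ => ENNReal.ofReal_lt_top), ← integral_const_mul]
  refine setIntegral_congr_fun measurableSet_Ioo fun θ hθ => ?_
  have h1 : 0 < Real.sin θ := Real.sin_pos_of_pos_of_lt_pi hθ.1 (by linarith [hθ.2, pi_pos])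
  have h2 : 0 < Real.cos θ := Real.cos_pos_of_mem_Ioo ⟨by linarith [hθ.1, pi_pos], hθ.2⟩
  have hs : Real.sin θ ^ (2 * α + 1) = (Real.sin θ ^ 2) ^ α * Real.sin θ := by
    rw [Real.rpow_add h1, Real.rpow_one, Real.rpow_mul h1.le]
    norm_cast
  have hc : Real.cos θ ^ (2 * β + 1) = (1 - Real.sin θ ^ 2) ^ β * Real.cos θ := by
    rw [Real.rpow_add h2, Real.rpow_one, Real.rpow_mul h2.le, ← Real.cos_sq']
    norm_cast
  simp only [smul_eq_mul]
  rw [ENNReal.toReal_ofReal (by positivity), abs_of_pos (by positivity), hs, hc, beta,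
    show α + 1 + (β + 1) = α + β + 2 by ring]
  field_simp

theorem KK_one (α β : ℝ) (n : ℕ) :
    KK α β n 1 = poch (α + β + 2) n / poch (β + 1) n * (poch (α + 2) n / (n.factorial : ℝ)) := by
  rw [KK, jacobiP_eval_one, show α + 1 + 1 = α + 2 by ring]

theorem poch_div_poch_mul_beta {α β : ℝ} (hα : -1 < α) (hβ : -1 < β) (n : ℕ) :
    poch (α + β + 2) n / poch (β + 1) n * beta (α + 1) (β + n + 1) = beta (α + 1) (β + 1) := by
  have h1 := Gamma_add_natCast (show 0 < β + 1 by linarith) n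
  have hs : 0 < α + β + 2 := by linarith
  have h2 := Gamma_add_natCast hs n
  have hp1 : poch (β + 1) n ≠ 0 := (ascPochhammer_pos n (β + 1) (by linarith)).ne'
  have hp2 : poch (α + β + 2) n ≠ 0 := (ascPochhammer_pos n _ hs).ne'
  have hG : Real.Gamma (α + β + 2) ≠ 0 := (Real.Gamma_pos_of_pos hs).ne'
  rw [beta, beta, show β + n + 1 = β + 1 + n by ring,
    show α + 1 + (β + 1 + n) = α + β + 2 + n by ring, show α + 1 + (β + 1) = α + β + 2 by ring,
    h1, h2]
  field_simp

theorem integral_log_one_div_sin_mul_KK {α β : ℝ} (hα : -1 < α) (hβ : -1 < β) (n : ℕ) :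
    ∫ θ, Real.log (1 / Real.sin θ) * (KK α β n 1 ^ 2 - KK α β n (Real.cos (2 * θ)) ^ 2)
        ∂(nuMeasure α β) =
      1 / 2 * (digamma (α + β + 2) - digamma (α + 1)) * KK α β n 1 ^ 2 -
        KK α β n 1 * (1 / 2 * (digamma (α + β + 2 + n) + digamma (α + 2 + n) -
          digamma (α + 1) - digamma (α + 2))) := by
  have ha : 0 < α + 1 := by linarith
  have hb : 0 < β + 1 := by linarith
  set p := poch (α + β + 2) n / poch (β + 1) n with hp
  have hfun : ∀ θ : ℝ, Real.log (1 / Real.sin θ) *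
      (KK α β n 1 ^ 2 - KK α β n (Real.cos (2 * θ)) ^ 2) =
      (fun u => -(1 / 2) * Real.log u *
        (KK α β n 1 ^ 2 - p ^ 2 * jacobiP (α + 1) β n (1 - 2 * u) ^ 2)) (Real.sin θ ^ 2) := by
    intro θ
    simp only
    rw [Real.cos_two_mul', Real.cos_sq', one_div, Real.log_inv, Real.log_pow, KK, KK,
      show 1 - Real.sin θ ^ 2 - Real.sin θ ^ 2 = 1 - 2 * Real.sin θ ^ 2 by ring]
    push_cast
    ring
  refine (integral_congr_ae (Eventually.of_forall hfun)).trans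
    ((integral_nuMeasure hα hβ (fun u => -(1 / 2) * Real.log u *
      (KK α β n 1 ^ 2 - p ^ 2 * jacobiP (α + 1) β n (1 - 2 * u) ^ 2))).trans ?_)
  have hL := integrableOn_logBeta ha hb
  obtain ⟨hJ, hJ'⟩ := integral_log_mul_jacobiP_sq ha hβ n
  have hL' := logBeta_eq ha hb
  rw [logBeta] at hL'
  simp only [add_sub_cancel_right] at hL hL' hJ hJ'
  have hsplit : ∀ u : ℝ, -(1 / 2) * Real.log u *
      (KK α β n 1 ^ 2 - p ^ 2 * jacobiP (α + 1) β n (1 - 2 * u) ^ 2) * (u ^ α * (1 - u) ^ β) =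
      -(1 / 2) * KK α β n 1 ^ 2 * (Real.log u * (u ^ α * (1 - u) ^ β)) + 1 / 2 * p ^ 2 *
        (Real.log u * (jacobiP (α + 1) β n (1 - 2 * u) ^ 2 * (u ^ α * (1 - u) ^ β))) :=
    fun u => by ring
  simp only [hsplit]
  rw [integral_add (hL.const_mul _) (hJ.const_mul _), integral_const_mul, integral_const_mul,
    hL', hJ', KK_one, ← hp, show α + 1 + (β + 1) = α + β + 2 by ring,
    show α + 1 + 1 = α + 2 by ring, show α + 1 + β + n + 1 = α + β + 2 + n by ring,
    show α + 1 + n + 1 = α + 2 + n by ring]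
  have hB := poch_div_poch_mul_beta hα hβ n
  rw [← hp] at hB
  have hB0 : beta (α + 1) (β + 1) ≠ 0 := (beta_pos ha hb).ne'
  rw [inv_mul_eq_iff_eq_mul₀ hB0]
  linear_combination (1 / 2 * p * (poch (α + 2) n / (n.factorial : ℝ)) * (digamma (α + 1) +
    digamma (α + 2) - digamma (α + β + 2 + n) - digamma (α + 2 + n))) * hB

/-! ### Asymptotics -/

theorem abs_digamma_sub_log_le {c : ℝ} (hc : 0 ≤ c) {x : ℝ} (hx : 0 < x) :
    |digamma (c + x) - Real.log x| ≤ (c + 1) / x := by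
  have hcx : 0 < c + x := by linarith
  have h1 := digamma_le_log hcx
  have h2 := log_sub_le_digamma hcx
  have h3 : Real.log x ≤ Real.log (c + x) := Real.log_le_log hx (by linarith)
  have h4 : 1 / (c + x) ≤ 1 / x := one_div_le_one_div_of_le hx (by linarith)
  have h5 : Real.log (c + x) - Real.log x ≤ c / x := by
    rw [← Real.log_div hcx.ne' hx.ne']
    refine (Real.log_le_sub_one_of_pos (by positivity)).trans (le_of_eq ?_)
    field_simp
    ring
  have h6 : 0 ≤ c / x := by positivity
  have h7 : 0 ≤ 1 / x := by positivity
  rw [add_div, abs_le]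
  constructor <;> linarith

theorem isBigO_digamma_sub_log {c : ℝ} (hc : 0 ≤ c) :
    (fun n : ℕ => digamma (c + n) - Real.log n) =O[atTop] fun n : ℕ => (n : ℝ)⁻¹ := by
  refine IsBigO.of_bound (c + 1) ?_
  filter_upwards [eventually_gt_atTop 0] with n hn
  have hn' : (0 : ℝ) < n := Nat.cast_pos.mpr hn
  rw [norm_inv, Real.norm_eq_abs, Real.norm_eq_abs, abs_of_pos hn', ← div_eq_mul_inv]
  exact abs_digamma_sub_log_le hc hn'

theorem isBigO_log_Gamma_sub {a b : ℝ} (hb : 0 ≤ b) (hab : b < a) :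
    (fun n : ℕ => Real.log (Real.Gamma (a + n)) - Real.log (Real.Gamma (b + n)) -
      (a - b) * Real.log n) =O[atTop] fun n : ℕ => (n : ℝ)⁻¹ := by
  refine IsBigO.of_bound ((a - b) * (a + 1)) ?_
  filter_upwards [eventually_gt_atTop 0] with n hn
  have hn' : (0 : ℝ) < n := Nat.cast_pos.mpr hn
  have hd : ∀ x ∈ Set.Icc b a,
      HasDerivAt (fun z => Real.log (Real.Gamma (z + n))) (digamma (x + n)) x := fun x hx =>
    (hasDerivAt_log_Gamma (show 0 < x + n by linarith [hx.1])).comp_add_const x n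
  obtain ⟨ξ, hξ, h⟩ := exists_hasDerivAt_eq_slope _ (fun x => digamma (x + n)) hab
    (fun x hx => (hd x hx).continuousAt.continuousWithinAt)
    (fun x hx => hd x (Set.Ioo_subset_Icc_self hx))
  have hab' : 0 < a - b := sub_pos.mpr hab
  rw [eq_div_iff hab'.ne'] at h
  rw [← h, mul_comm, ← mul_sub, norm_mul, norm_inv, Real.norm_eq_abs, Real.norm_eq_abs,
    Real.norm_eq_abs, abs_of_pos hn', abs_of_pos hab', mul_assoc, ← div_eq_mul_inv]
  refine mul_le_mul_of_nonneg_left ?_ hab'.le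
  refine (abs_digamma_sub_log_le (hb.trans hξ.1.le) hn').trans ?_
  have := hξ.2.le
  gcongr

theorem isBigO_KK_one_sub {α β : ℝ} (hα : -1 < α) (hβ : -1 < β) :
    (fun n : ℕ => KK α β n 1 - Real.Gamma (β + 1) /
        (Real.Gamma (α + 2) * Real.Gamma (α + β + 2)) * (n : ℝ) ^ (2 * α + 2))
      =O[atTop] fun n : ℕ => (n : ℝ) ^ (2 * α + 1) := by
  set C := Real.Gamma (β + 1) / (Real.Gamma (α + 2) * Real.Gamma (α + β + 2)) with hC
  set E : ℕ → ℝ := fun n =>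
    (Real.log (Real.Gamma (α + β + 2 + n)) - Real.log (Real.Gamma (β + 1 + n)) -
      (α + β + 2 - (β + 1)) * Real.log n) +
    (Real.log (Real.Gamma (α + 2 + n)) - Real.log (Real.Gamma (1 + n)) -
      (α + 2 - 1) * Real.log n) with hE
  have hEO : E =O[atTop] fun n : ℕ => (n : ℝ)⁻¹ :=
    (isBigO_log_Gamma_sub (by linarith) (by linarith)).add
      (isBigO_log_Gamma_sub (by linarith) (by linarith))
  have hE0 : Tendsto E atTop (nhds 0) := hEO.trans_tendsto tendsto_inv_atTop_nhds_zero_nat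
  have hexp : (fun n => Real.exp (E n) - 1) =O[atTop] fun n : ℕ => (n : ℝ)⁻¹ := by
    have h := (Real.hasDerivAt_exp 0).isBigO_sub.comp_tendsto hE0
    simp only [Function.comp_def, Real.exp_zero, sub_zero] at h
    exact h.trans hEO
  have hmul := ((isBigO_refl (fun n : ℕ => (n : ℝ) ^ (2 * α + 2)) atTop).const_mul_left C).mul hexp
  refine hmul.congr' ?_ ?_
  · filter_upwards [eventually_gt_atTop 0] with n hn
    have hn' : (0 : ℝ) < n := Nat.cast_pos.mpr hn
    have hK : KK α β n 1 = C * (Real.Gamma (α + β + 2 + n) / Real.Gamma (β + 1 + n) *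
        (Real.Gamma (α + 2 + n) / Real.Gamma (1 + n))) := by
      have hG1 := (Real.Gamma_pos_of_pos (show 0 < β + 1 by linarith)).ne'
      have hG2 := (Real.Gamma_pos_of_pos (show 0 < α + 2 by linarith)).ne'
      have hG3 := (Real.Gamma_pos_of_pos (show 0 < α + β + 2 by linarith)).ne'
      rw [KK_one, Gamma_add_natCast (by linarith), Gamma_add_natCast (by linarith),
        Gamma_add_natCast (by linarith), Gamma_add_natCast one_pos, poch_one, Real.Gamma_one, hC]
      field_simp
    have hg1 := Real.Gamma_pos_of_pos (show 0 < α + β + 2 + n by linarith)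
    have hg2 := Real.Gamma_pos_of_pos (show 0 < β + 1 + n by linarith)
    have hg3 := Real.Gamma_pos_of_pos (show 0 < α + 2 + n by linarith)
    have hg4 := Real.Gamma_pos_of_pos (show 0 < 1 + (n : ℝ) by linarith)
    have hpow : (n : ℝ) ^ (2 * α + 2) * Real.exp (E n) =
        Real.Gamma (α + β + 2 + n) / Real.Gamma (β + 1 + n) *
          (Real.Gamma (α + 2 + n) / Real.Gamma (1 + n)) := by
      rw [Real.rpow_def_of_pos hn', ← Real.exp_add, ← Real.exp_log (div_pos hg1 hg2),
        ← Real.exp_log (div_pos hg3 hg4), ← Real.exp_add, Real.log_div hg1.ne' hg2.ne',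
        Real.log_div hg3.ne' hg4.ne']
      congr 1
      simp only [hE]
      ring
    rw [hK, ← hpow]
    ring
  · filter_upwards [eventually_gt_atTop 0] with n hn
    have hn' : (0 : ℝ) < n := Nat.cast_pos.mpr hn
    rw [← Real.rpow_neg_one, ← Real.rpow_add hn']
    congr 1
    ring

theorem IsProjParam.neg_one_lt {α β : ℝ} (h : IsProjParam α β) : -1 < α ∧ -1 < β := by
  rcases h with ⟨d, hd, rfl, rfl⟩ | ⟨d, hd, rfl, rfl⟩ | ⟨d, hd, rfl, rfl⟩ | ⟨rfl, rfl⟩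
  on_goal 4 => norm_num
  all_goals
    have hd' : (3 : ℝ) ≤ d := by exact_mod_cast hd
    constructor <;> linarith

/-- The expected chordal logarithmic energy of the harmonic ensemble. -/
theorem stmt13 (α β : ℝ) (h : IsProjParam α β) :
    (fun n : ℕ =>
        (∫ θ, Real.log (1 / Real.sin θ) * (KK α β n 1 ^ 2 - KK α β n (Real.cos (2 * θ)) ^ 2)
            ∂(nuMeasure α β))
          - (1 / 2 * (digamma (α + β + 2) - digamma (α + 1)) * KK α β n 1 ^ 2
              - Real.Gamma (β + 1) / (Real.Gamma (α + 2) * Real.Gamma (α + β + 2)) *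
                  (n : ℝ) ^ (2 * α + 2) *
                  (Real.log n - (digamma (α + 1) + digamma (α + 2)) / 2)))
      =O[atTop] fun n : ℕ => (n : ℝ) ^ (2 * α + 1) * Real.log n := by
  obtain ⟨hα, hβ⟩ := h.neg_one_lt
  set C := Real.Gamma (β + 1) / (Real.Gamma (α + 2) * Real.Gamma (α + β + 2))
  set s := digamma (α + 1) + digamma (α + 2)
  have hlog : Tendsto (fun n : ℕ => Real.log n) atTop atTop :=
    Real.tendsto_log_atTop.comp tendsto_natCast_atTop_atTop
  have hone (c : ℝ) : (fun _ : ℕ => c) =O[atTop] fun n : ℕ => Real.log n :=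
    (isLittleO_const_left.mpr (Or.inr (tendsto_norm_atTop_atTop.comp hlog))).isBigO
  have hK := isBigO_KK_one_sub hα hβ
  have hpow : (fun n : ℕ => (n : ℝ) ^ (2 * α + 1)) =O[atTop]
      fun n : ℕ => (n : ℝ) ^ (2 * α + 2) := by
    refine IsBigO.of_bound 1 ?_
    filter_upwards [eventually_ge_atTop 1] with n hn
    have hn' : (1 : ℝ) ≤ n := Nat.one_le_cast.mpr hn
    rw [one_mul, Real.norm_of_nonneg (by positivity), Real.norm_of_nonneg (by positivity)]
    exact Real.rpow_le_rpow_of_exponent_le hn' (by linarith)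
  have hK' : (fun n : ℕ => KK α β n 1) =O[atTop] fun n : ℕ => (n : ℝ) ^ (2 * α + 2) := by
    simpa [C] using (hK.trans hpow).add
      ((isBigO_refl (fun n : ℕ => (n : ℝ) ^ (2 * α + 2)) atTop).const_mul_left C)
  have hψ := ((isBigO_digamma_sub_log (show 0 ≤ α + β + 2 by linarith)).add
    (isBigO_digamma_sub_log (show 0 ≤ α + 2 by linarith))).const_mul_left (1 / 2)
  have h1 := hK.mul ((isBigO_refl (fun n : ℕ => Real.log n) atTop).sub (hone (s / 2)))
  have h2 : (fun n : ℕ => KK α β n 1 * (1 / 2 * (digamma (α + β + 2 + n) - Real.log n +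
      (digamma (α + 2 + n) - Real.log n)))) =O[atTop]
      fun n : ℕ => (n : ℝ) ^ (2 * α + 1) * Real.log n := by
    have h3 := ((hK'.mul hψ).congr' (EventuallyEq.refl _ _)
      (g₂ := fun n : ℕ => (n : ℝ) ^ (2 * α + 1)) ?_).mul (hone 1)
    · simpa using h3
    · filter_upwards [eventually_gt_atTop 0] with n hn
      have hn' : (0 : ℝ) < n := Nat.cast_pos.mpr hn
      rw [← Real.rpow_neg_one, ← Real.rpow_add hn']
      congr 1
      ring
  refine (h1.add h2).neg_left.congr_left fun n => ?_
  rw [integral_log_one_div_sin_mul_KK hα hβ]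
  ring
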